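/- Let P be a one-parameter FISI deformation of a polynomial f₀ of degree d > 2 whose total space Y is nonsingular for |s| small (equivalently Σ₀ ∩ {φ_d = 0} = ∅). Assume that for some t ∈ ℂ all singularities of the fiber Y_{0,t} lying on the hyperplane at infinity H^∞ are of type A₁, i.e. at each such singular point the local chart equation of Y_{0,t} has vanishing gradient and nondegenerate Hessian. Then Γ_{II} = ∅: there is no sequence (x_k, s_k) with ∂P/∂x_i(x_k, s_k) = 0 for all i, s_k → 0, |x_k| → ∞, and P(x_k, s_k) converging to a finite value; equivalently, no affine critical point of f_s tends to a point of H^∞ with bounded critical value as s → 0. -/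

import Mathlib

open MvPolynomial Filter CategoryTheory Limits Topology

noncomputable section

abbrev XS (n : ℕ) := Fin n ⊕ Unit
abbrev HV (n : ℕ) := Fin n ⊕ Unit
abbrev TV (n : ℕ) := Fin n ⊕ Fin 3

/-- ℙ^{n-1}, the hyperplane at infinity of ℙⁿ. -/
abbrev PrjInf (n : ℕ) := Projectivization ℂ (Fin n → ℂ)
/-- ℙⁿ. -/
abbrev Prj (n : ℕ) := Projectivization ℂ (HV n → ℂ)

/-- weights for the degree in the `x`-variables only: `s` has weight `0`. -/
def wtx (n : ℕ) : XS n → ℕ := Sum.elim (fun _ => 1) (fun _ => 0)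

/-- `P_q`, the degree-`q` homogeneous part of `P` in the variables `x`. -/
def xpart {n : ℕ} (P : MvPolynomial (XS n) ℂ) (q : ℕ) : MvPolynomial (XS n) ℂ :=
  weightedHomogeneousComponent (wtx n) q P

/-- the evaluation point `(x, s)`. -/
def evA {n : ℕ} (x : Fin n → ℂ) (s : ℂ) : XS n → ℂ := Sum.elim x (fun _ => s)

/-- `deg_x P(·,s) = d` at the parameter value `s`. -/
def DegXAt {n : ℕ} (d : ℕ) (P : MvPolynomial (XS n) ℂ) (s : ℂ) : Prop :=
  (∀ q, d < q → ∀ x : Fin n → ℂ, eval (evA x s) (xpart P q) = 0) ∧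
  (∃ x : Fin n → ℂ, eval (evA x s) (xpart P d) ≠ 0)

/-- the substitution embedding the variables `(x,s)` into the variables `(x,x₀,s,t)`. -/
def embT {n : ℕ} : XS n → MvPolynomial (TV n) ℂ :=
  Sum.elim (fun i => X (Sum.inl i)) (fun _ => X (Sum.inr 1))

/-- The defining polynomial `F = P̃(x,x₀,s) - t·x₀^d` of the total space
`Y ⊂ ℙⁿ × ℂ_s × ℂ_t`, where `P̃ = Σ_{q ≤ d} x₀^{d-q} P_q(x,s)` is the homogenization
of `P` in `x` by the variable `x₀`. -/
def FY {n : ℕ} (d : ℕ) (P : MvPolynomial (XS n) ℂ) : MvPolynomial (TV n) ℂ :=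
  (∑ q ∈ Finset.range (d+1), (X (Sum.inr 0))^(d-q) * aeval embT (xpart P q))
    - X (Sum.inr 2) * (X (Sum.inr 0))^d

/-- the evaluation point `((x,x₀), s, t)` of the variables of `FY`. -/
def evT {n : ℕ} (u : HV n → ℂ) (s t : ℂ) : TV n → ℂ :=
  Sum.elim (fun i => u (Sum.inl i)) ![u (Sum.inr ()), s, t]

/-- `([u], s, t) ∈ Y`. -/
def OnY {n : ℕ} (d : ℕ) (P : MvPolynomial (XS n) ℂ) (u : HV n → ℂ) (s t : ℂ) : Prop :=
  eval (evT u s t) (FY d P) = 0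

/-- all partial derivatives of the defining equation of `Y` — with respect to the
homogeneous coordinates `(x, x₀)` and the affine coordinates `s, t` — vanish at
`([u], s, t)`; together with `OnY` this says `([u],s,t)` is a singular point of `Y`. -/
def AllDerivsVanish {n : ℕ} (d : ℕ) (P : MvPolynomial (XS n) ℂ) (u : HV n → ℂ)
    (s t : ℂ) : Prop :=
  ∀ v : TV n, eval (evT u s t) (pderiv v (FY d P)) = 0

/-- the partial derivatives with respect to the homogeneous coordinates `(x, x₀)`
vanish at `([u], s, t)`; together with `OnY` this says `[u]` is a singular point of the
projective fiber `Y_{s,t}`. -/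
def FiberDerivsVanish {n : ℕ} (d : ℕ) (P : MvPolynomial (XS n) ℂ) (u : HV n → ℂ)
    (s t : ℂ) : Prop :=
  (∀ i : Fin n, eval (evT u s t) (pderiv (Sum.inl i) (FY d P)) = 0) ∧
    eval (evT u s t) (pderiv (Sum.inr 0) (FY d P)) = 0

/-- the partial derivatives with respect to `(x, x₀)` and `t` (but not `s`) vanish;
together with `OnY` this identifies the singular points of `Y_{s,ℂ}`, resp. the critical
points of the projection `σ : Y → ℂ_s`. -/
def SliceDerivsVanish {n : ℕ} (d : ℕ) (P : MvPolynomial (XS n) ℂ) (u : HV n → ℂ)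
    (s t : ℂ) : Prop :=
  FiberDerivsVanish d P u s t ∧ eval (evT u s t) (pderiv (Sum.inr 2) (FY d P)) = 0

/-- `[x] ∈ W_s`: all `∂P_d/∂x_i` vanish at `(x,s)`. -/
def WCond {n : ℕ} (d : ℕ) (P : MvPolynomial (XS n) ℂ) (x : Fin n → ℂ) (s : ℂ) : Prop :=
  ∀ i : Fin n, eval (evA x s) (pderiv (Sum.inl i) (xpart P d)) = 0

/-- `[x] ∈ Σ_s`: moreover `P_{d-1}(x,s) = 0`. -/
def SCond {n : ℕ} (d : ℕ) (P : MvPolynomial (XS n) ℂ) (x : Fin n → ℂ) (s : ℂ) : Prop :=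
  WCond d P x s ∧ eval (evA x s) (xpart P (d-1)) = 0

/-- `φ_d(x) = ∂P_d/∂s (x, 0) = 0`. -/
def PhiCond {n : ℕ} (d : ℕ) (P : MvPolynomial (XS n) ℂ) (x : Fin n → ℂ) : Prop :=
  eval (evA x 0) (pderiv (Sum.inr ()) (xpart P d)) = 0

/-- `W_s ⊂ ℙ^{n-1}` as a set of projective points. -/
def Wset {n : ℕ} (d : ℕ) (P : MvPolynomial (XS n) ℂ) (s : ℂ) : Set (PrjInf n) :=
  {p | WCond d P p.rep s}

/-- `Σ_s ⊂ ℙ^{n-1}` as a set of projective points. -/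
def Sigset {n : ℕ} (d : ℕ) (P : MvPolynomial (XS n) ℂ) (s : ℂ) : Set (PrjInf n) :=
  {p | SCond d P p.rep s}

/-- `f_s = P(·,s)` as a polynomial in `x`. -/
def fS {n : ℕ} (P : MvPolynomial (XS n) ℂ) (s : ℂ) : MvPolynomial (Fin n) ℂ :=
  aeval (Sum.elim X (fun _ => C s)) P

/-- `x` is an affine critical point of `f_s`, i.e. `∂P/∂x_i(x,s) = 0` for all `i`. -/
def CritPt {n : ℕ} (P : MvPolynomial (XS n) ℂ) (x : Fin n → ℂ) (s : ℂ) : Prop :=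
  ∀ i : Fin n, eval (evA x s) (pderiv (Sum.inl i) P) = 0

/-- the set of singular points of the compactified fiber `Y_{s,t} ⊂ ℙⁿ`. -/
def SingYst {n : ℕ} (d : ℕ) (P : MvPolynomial (XS n) ℂ) (s t : ℂ) : Set (Prj n) :=
  {p | OnY d P p.rep s t ∧ FiberDerivsVanish d P p.rep s t}

/-- `f₀ = P(·,0)` is a FISI polynomial: it has finitely many critical points, the
projective closure of each of its fibers has only isolated (= finitely many) singular
points, and the singular locus `W₀` of the slice at infinity is finite. -/
def FISIat {n : ℕ} (d : ℕ) (P : MvPolynomial (XS n) ℂ) (s : ℂ) : Prop :=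
  {x : Fin n → ℂ | CritPt P x s}.Finite ∧ (∀ t : ℂ, (SingYst d P s t).Finite) ∧
    (Wset d P s).Finite

/-- `P` is a FISI deformation: `f₀` is FISI, `W₀` is finite and every `f_s`, for `s` in a
neighbourhood of `0`, has only finitely many critical points. -/
def FISIdef {n : ℕ} (d : ℕ) (P : MvPolynomial (XS n) ℂ) : Prop :=
  FISIat d P 0 ∧ ∃ ε > (0:ℝ), ∀ s : ℂ, ‖s‖ < ε → {x : Fin n → ℂ | CritPt P x s}.Finite

/-- The "Milnor-type" local dimension: given polynomial germs `gs` at a point `a ∈ ℂᵐ`,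
this is the `ℂ`-dimension of the formal power series ring at `a` (identified with
`ℂ[[X]]` via `X ↦ X - a`) modulo the ideal generated by the germs. -/
def germDim {m : ℕ} (gs : Set (MvPolynomial (Fin m) ℂ)) (a : Fin m → ℂ) : ℕ :=
  Module.finrank ℂ (MvPowerSeries (Fin m) ℂ ⧸ Ideal.span
    ((fun g => (MvPolynomial.coeToMvPowerSeries.ringHom
        (aeval (fun i => X i + C (a i)) g) : MvPowerSeries (Fin m) ℂ)) '' gs))

/-- the (choice of an) index `j` with `p.rep j ≠ 0`, used to normalize `v_j = 1`
and to work in the chart `x_j = 1` of `ℙⁿ`. -/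
def jp {n : ℕ} (p : PrjInf n) : Fin n :=
  (Function.ne_iff.mp p.rep_nonzero).choose

lemma jp_spec {n : ℕ} (p : PrjInf n) : p.rep (jp p) ≠ 0 :=
  (Function.ne_iff.mp p.rep_nonzero).choose_spec

/-- the chart coordinates of the point at infinity `p = [v:0]`, where `v` is normalized
by `v_{j(p)} = 1`, in the chart `x_{j(p)} = 1` of `ℙⁿ`; the slot `j(p)` of the chart
carries the coordinate `x₀`, which is `0` at `p`. -/
def chartPt {n : ℕ} (p : PrjInf n) : Fin n → ℂ :=
  fun i => if i = jp p then 0 else p.rep i / p.rep (jp p)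

/-- the chart equation of the compactified fiber `Y_{s,t}` in the chart `x_j = 1` of
`ℙⁿ`: substitute `x_j = 1` in the homogeneous defining equation `FY`, the chart slot `j`
carrying the coordinate `x₀`. -/
def chartEq {n : ℕ} (d : ℕ) (P : MvPolynomial (XS n) ℂ) (j : Fin n) (s t : ℂ) :
    MvPolynomial (Fin n) ℂ :=
  aeval (Sum.elim (fun i => if i = j then 1 else X i) ![X j, C s, C t]) (FY d P)

/-- the chart equation of the hypersurface `{P_d(·,s) = 0} ⊂ ℙ^{n-1}` in the chart
`x_j = 1` of `ℙ^{n-1}` (the chart variable `X j` is unused). -/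
def chartEqInf {n : ℕ} (d : ℕ) (P : MvPolynomial (XS n) ℂ) (j : Fin n) (s : ℂ) :
    MvPolynomial (Fin n) ℂ :=
  aeval (fun i => if i = j then 1 else X i) (aeval (Sum.elim X (fun _ => C s)) (xpart P d))

/-- `μ_p(t,s)`, the Milnor number of the isolated singularity of the compactified fiber
`Y_{s,t}` at the point `p` of the hyperplane at infinity. -/
def muP {n : ℕ} (d : ℕ) (P : MvPolynomial (XS n) ℂ) (p : PrjInf n) (s t : ℂ) : ℕ :=
  germDim (Set.range fun i => pderiv i (chartEq d P (jp p) s t)) (chartPt p)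

/-- `μ_{p,gen}(s) = min_{t ∈ ℂ} μ_p(t,s)`. -/
def muGen {n : ℕ} (d : ℕ) (P : MvPolynomial (XS n) ℂ) (p : PrjInf n) (s : ℂ) : ℕ :=
  sInf (Set.range (muP d P p s))

/-- the local Milnor–Lê number `λ_{p,t}(s) = μ_p(t,s) − μ_{p,gen}(s)`. -/
def lamP {n : ℕ} (d : ℕ) (P : MvPolynomial (XS n) ℂ) (p : PrjInf n) (t s : ℂ) : ℕ :=
  muP d P p s t - muGen d P p s

/-- `μ_p^∞(s)`, the Milnor number at `p` of the hypersurface `{P_d(·,s)=0} ⊂ ℙ^{n-1}`: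
computed in the chart `x_{j(p)} = 1`, adding the generator `X (j p)` to kill the unused
chart variable. -/
def muInf {n : ℕ} (d : ℕ) (P : MvPolynomial (XS n) ℂ) (p : PrjInf n) (s : ℂ) : ℕ :=
  germDim ({g | ∃ i, i ≠ jp p ∧ g = pderiv i (chartEqInf d P (jp p) s)} ∪ {X (jp p)})
    (chartPt p)

/-- the total Milnor number `μ(s)` of the affine singularities of `f_s`. -/
def muTot {n : ℕ} (P : MvPolynomial (XS n) ℂ) (s : ℂ) : ℕ :=
  Module.finrank ℂ (MvPolynomial (Fin n) ℂ ⧸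
    Ideal.span (Set.range fun i => pderiv i (fS P s)))

/-- the local Milnor number `μ_a(f_s)` of `f_s` at the point `a ∈ ℂⁿ`. -/
def muAt {n : ℕ} (P : MvPolynomial (XS n) ℂ) (s : ℂ) (a : Fin n → ℂ) : ℕ :=
  germDim (Set.range fun i => pderiv i (fS P s)) a

/-- the total Milnor–Lê number at infinity `λ(s) = Σ_{p ∈ Σ_s} Σ_{t ∈ ℂ} λ_{p,t}(s)`
(all but finitely many summands vanish). -/
def lamTot {n : ℕ} (d : ℕ) (P : MvPolynomial (XS n) ℂ) (s : ℂ) : ℕ :=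
  ∑ᶠ p ∈ Sigset d P s, ∑ᶠ t : ℂ, lamP d P p t s

/-- the chart coordinates of the affine point `[x : 1] ∈ ℙⁿ` in the chart `x_j = 1`,
the slot `j` carrying the coordinate `x₀` (i.e. `1/x_j`). -/
def chartCo {n : ℕ} (j : Fin n) (x : Fin n → ℂ) : Fin n → ℂ :=
  fun i => if i = j then 1 / x j else x i / x j

/-- the affine discriminant `Δ_P ⊂ ℂ_s × ℂ_t`: the closure of the set of pairs
`(s, f_s(x))` over the affine critical points `x` of `f_s`. -/
def DeltaP {n : ℕ} (P : MvPolynomial (XS n) ℂ) : Set (ℂ × ℂ) :=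
  closure {w : ℂ × ℂ | ∃ x : Fin n → ℂ, CritPt P x w.1 ∧ w.2 = eval (evA x w.1) P}

lemma hlp_whom_aeval {σ τ : Type*} {w : σ → ℕ} {w' : τ → ℕ} {q : ℕ} {φ : MvPolynomial σ ℂ}
    (h : φ.IsWeightedHomogeneous w q) (g : σ → MvPolynomial τ ℂ)
    (hg : ∀ i, (g i).IsWeightedHomogeneous w' (w i)) :
    (aeval g φ).IsWeightedHomogeneous w' q := by
  classical
  rw [aeval_def, eval₂_eq]
  apply IsWeightedHomogeneous.sum
  intro m hm
  have h1 := h (mem_support_iff.mp hm)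
  have h2 : (∏ i ∈ m.support, g i ^ m i).IsWeightedHomogeneous w'
      (∑ i ∈ m.support, m i • w i) :=
    IsWeightedHomogeneous.prod _ _ _ (fun i _ => (hg i).pow (m i))
  have h3 : (∑ i ∈ m.support, m i • w i) = q := by
    rw [← h1, Finsupp.weight_apply, Finsupp.sum]
  rw [h3] at h2
  have := (isWeightedHomogeneous_C w' (coeff m φ)).mul h2
  rwa [zero_add] at this

lemma hlp_whom_eval {σ : Type*} [Fintype σ] {w : σ → ℕ} {q : ℕ} {φ : MvPolynomial σ ℂ}
    (h : φ.IsWeightedHomogeneous w q) (c : ℂ) (u : σ → ℂ) :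
    eval (fun i => c ^ (w i) * u i) φ = c ^ q * eval u φ := by
  classical
  rw [eval_eq', eval_eq', Finset.mul_sum]
  refine Finset.sum_congr rfl fun m hm => ?_
  have h1 := h (mem_support_iff.mp hm)
  have h3 : (∑ i, m i * w i) = q := by
    rw [← h1, Finsupp.weight_apply, Finsupp.sum_fintype] <;> simp
  simp_rw [mul_pow]
  rw [Finset.prod_mul_distrib, ← h3, ← Finset.prod_pow_eq_pow_sum]
  simp_rw [← pow_mul, mul_comm (w _)]
  ring

def hlpWt (n : ℕ) : TV n → ℕ := Sum.elim (fun _ => 1) ![1, 0, 0]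

lemma hlp_FY_whom {n : ℕ} (d : ℕ) (P : MvPolynomial (XS n) ℂ) :
    (FY d P).IsWeightedHomogeneous (hlpWt n) d := by
  have hX : ∀ a : ℕ, ((X (Sum.inr 0) : MvPolynomial (TV n) ℂ) ^ a).IsWeightedHomogeneous
      (hlpWt n) a := by
    intro a
    have := (isWeightedHomogeneous_X ℂ (hlpWt n) (Sum.inr 0)).pow a
    simpa [hlpWt] using this
  have h2 : (X (Sum.inr 2) : MvPolynomial (TV n) ℂ).IsWeightedHomogeneous (hlpWt n) 0 :=
    isWeightedHomogeneous_X ℂ (hlpWt n) (Sum.inr 2)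
  have h3 := h2.mul (hX d)
  rw [zero_add] at h3
  refine (weightedHomogeneousSubmodule ℂ (hlpWt n) d).sub_mem ?_ h3
  apply IsWeightedHomogeneous.sum
  intro q hq
  have h4 : (aeval embT (xpart P q)).IsWeightedHomogeneous (hlpWt n) q := by
    apply hlp_whom_aeval (weightedHomogeneousComponent_isWeightedHomogeneous q P)
    rintro (i | i)
    · exact isWeightedHomogeneous_X ℂ (hlpWt n) (Sum.inl i)
    · exact isWeightedHomogeneous_X ℂ (hlpWt n) (Sum.inr 1)
  have h5 := (hX (d - q)).mul h4
  rwa [Nat.sub_add_cancel (by simpa [Nat.lt_succ_iff] using hq)] at h5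

/-- chain rule for variables -/
lemma hlp_pderiv_aeval {σ τ : Type*} (g : σ → MvPolynomial τ ℂ) (a : τ) (b : σ)
    (h1 : pderiv a (g b) = 1) (h2 : ∀ c, c ≠ b → pderiv a (g c) = 0) (φ : MvPolynomial σ ℂ) :
    pderiv a (aeval g φ) = aeval g (pderiv b φ) := by
  classical
  induction φ using MvPolynomial.induction_on with
  | C r => simp
  | add p q hp hq => simp only [map_add, hp, hq]
  | mul_X p c hp =>
    simp only [map_mul, aeval_X, Derivation.leibniz, hp, smul_eq_mul, map_add, pderiv_X]
    by_cases hc : c = b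
    · subst hc; simp [h1]
    · simp [h2 c hc, Pi.single_apply, hc]

lemma hlp_strict {σ : Type*} [Fintype σ] (φ : MvPolynomial σ ℂ) (u : σ → ℂ) :
    HasStrictFDerivAt (fun u : σ → ℂ => eval u φ)
      (∑ b, eval u (pderiv b φ) • (ContinuousLinearMap.proj b : (σ → ℂ) →L[ℂ] ℂ)) u := by
  classical
  induction φ using MvPolynomial.induction_on with
  | C r => 
    refine ((hasStrictFDerivAt_const (𝕜 := ℂ) r u).congr_fderiv ?_).congr_of_eventuallyEq ?_
    · ext v; simp
    · exact Filter.Eventually.of_forall fun v => by simp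
  | add p q hp hq =>
    refine ((hp.add hq).congr_fderiv ?_).congr_of_eventuallyEq ?_
    · ext v; simp [add_mul, Finset.sum_add_distrib]
    · exact Filter.Eventually.of_forall fun v => by simp
  | mul_X p c hp =>
    have h1 := hp.mul (ContinuousLinearMap.proj (R := ℂ) (φ := fun _ : σ => ℂ) c).hasStrictFDerivAt (x := u)
    simp only [map_mul, eval_X]
    refine h1.congr_fderiv ?_
    ext v
    simp [pderiv_X, Derivation.leibniz, add_mul, Finset.sum_add_distrib, Pi.single_apply,
      Finset.mul_sum, mul_assoc, apply_ite]

lemma hlp_inj {σ : Type*} [Fintype σ] (R : σ → MvPolynomial σ ℂ) (u : σ → ℂ)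
    (hk : ∀ w : σ → ℂ, (∀ a, ∑ b, eval u (pderiv b (R a)) * w b = 0) → w = 0) :
    ∃ Ψ : (σ → ℂ) → (σ → ℂ), ∀ᶠ x in nhds u, Ψ (fun a => eval x (R a)) = x := by
  classical
  let L : (σ → ℂ) →L[ℂ] (σ → ℂ) := ContinuousLinearMap.pi fun a =>
    ∑ b, eval u (pderiv b (R a)) • (ContinuousLinearMap.proj b : (σ → ℂ) →L[ℂ] ℂ)
  have hL : HasStrictFDerivAt (fun x : σ → ℂ => fun a => eval x (R a)) L u :=
    hasStrictFDerivAt_pi'' fun a => by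
      simpa [L] using hlp_strict (R a) u
  have hinj : Function.Injective (L : (σ → ℂ) →ₗ[ℂ] (σ → ℂ)) := by
    rw [injective_iff_map_eq_zero]
    intro w hw
    apply hk
    intro a
    have := congrFun hw a
    simpa [L] using this
  let e : (σ → ℂ) ≃L[ℂ] (σ → ℂ) := (LinearEquiv.ofInjectiveEndo _ hinj).toContinuousLinearEquiv
  have he : (e : (σ → ℂ) →L[ℂ] (σ → ℂ)) = L := by
    ext v; rfl
  rw [← he] at hL
  exact ⟨_, hL.eventually_left_inverse⟩

lemma hlp_xpart_zero {n d : ℕ} (P : MvPolynomial (XS n) ℂ)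
    (hdeg : ∃ ε > (0:ℝ), ∀ s : ℂ, ‖s‖ < ε → DegXAt d P s) (q : ℕ) (hq : d < q) :
    xpart P q = 0 := by
  obtain ⟨ε, hε, h⟩ := hdeg
  refine funext_set (Sum.elim (fun _ => Set.univ) (fun _ => Metric.ball 0 ε)) ?_ ?_
  · rintro (i | i)
    · exact Set.infinite_univ
    · exact (infinite_of_mem_nhds 0 (Metric.ball_mem_nhds 0 hε))
  · intro x hx
    have h1 := hx (Sum.inr ()) trivial
    have h2 := (h (x (Sum.inr ())) (by simpa using h1)).1 q hq (fun i => x (Sum.inl i))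
    have : evA (fun i => x (Sum.inl i)) (x (Sum.inr ())) = x := by
      ext (i | i) <;> rfl
    rw [this] at h2
    simpa using h2

lemma hlp_sum {n d : ℕ} (P : MvPolynomial (XS n) ℂ)
    (hz : ∀ q, d < q → xpart P q = 0) : ∑ q ∈ Finset.range (d+1), xpart P q = P := by
  conv_rhs => rw [← sum_weightedHomogeneousComponent (w := wtx n) P]
  rw [finsum_eq_sum_of_support_subset]
  · rfl
  · intro q hq
    by_contra hc
    simp only [Finset.coe_range, Set.mem_Iio, not_lt] at hc
    exact hq (hz q hc)

def hlpPt {n : ℕ} (j : Fin n) (y : Fin n → ℂ) (s t : ℂ) : TV n → ℂ :=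
  Sum.elim (fun i => if i = j then 1 else y i) ![y j, s, t]

def hlpV {n : ℕ} (j i : Fin n) : TV n := if i = j then Sum.inr 0 else Sum.inl i

lemma hlp_chart_pderiv {n : ℕ} (j i : Fin n) (s t : ℂ) (φ : MvPolynomial (TV n) ℂ) :
    pderiv i (aeval (Sum.elim (fun i => if i = j then 1 else X i) ![X j, C s, C t]) φ
        : MvPolynomial (Fin n) ℂ) =
      aeval (Sum.elim (fun i => if i = j then 1 else X i) ![X j, C s, C t])
        (pderiv (hlpV j i) φ) := by
  classical
  apply hlp_pderiv_aeval
  · by_cases h : i = j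
    · subst h; simp [hlpV]
    · simp [hlpV, h]
  · rintro (c | c) hc
    · by_cases h : i = j
      · subst h
        by_cases h' : c = i
        · simp [h']
        · simp [h', pderiv_X_of_ne]
      · by_cases h' : c = j
        · simp [h']
        · have : c ≠ i := by
            rintro rfl
            simp [hlpV, h] at hc
          simp [h', pderiv_X_of_ne this]
    · fin_cases c
      · have : i ≠ j := by
          rintro rfl
          simp [hlpV] at hc
        simp [pderiv_X_of_ne this.symm]
      · simp
      · simp

lemma hlp_chart_eval {n : ℕ} (j : Fin n) (y : Fin n → ℂ) (s t : ℂ) (φ : MvPolynomial (TV n) ℂ) :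
    eval y (aeval (Sum.elim (fun i => if i = j then 1 else X i) ![X j, C s, C t]) φ
        : MvPolynomial (Fin n) ℂ) = eval (hlpPt j y s t) φ := by
  induction φ using MvPolynomial.induction_on with
  | C r => simp
  | add p q hp hq => simp only [map_add, hp, hq]
  | mul_X p c hp =>
    simp only [map_mul, hp, aeval_X, eval_X]
    congr 1
    rcases c with c | c
    · by_cases h : c = j <;> simp [hlpPt, h]
    · fin_cases c <;> simp [hlpPt]

lemma hlp_chart_t {n d : ℕ} (P : MvPolynomial (XS n) ℂ) (j : Fin n) (s t : ℂ) :
    chartEq d P j s t = chartEq d P j s 0 - C t * X j ^ d := by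
  have : ∀ q, aeval (Sum.elim (fun i => if i = j then 1 else X i) ![X j, C s, C t])
      (aeval embT (xpart P q)) =
    (aeval (Sum.elim (fun i => if i = j then 1 else X i) ![X j, C s, C 0])
      (aeval embT (xpart P q)) : MvPolynomial (Fin n) ℂ) := by
    intro q
    rw [comp_aeval_apply, comp_aeval_apply]
    congr 2
    ext1 (i | i) <;> simp [embT]
  unfold chartEq FY
  simp only [map_sub, map_sum, map_mul, map_pow, this, aeval_X]
  simp

lemma hlp_crit_inl {n d : ℕ} (P : MvPolynomial (XS n) ℂ)
    (hz : ∀ q, d < q → xpart P q = 0) (x : Fin n → ℂ) (s t : ℂ) (φ : MvPolynomial (XS n) ℂ) :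
    eval (Sum.elim x ![1, s, t] : TV n → ℂ) (aeval embT φ) = eval (evA x s) φ := by
  induction φ using MvPolynomial.induction_on with
  | C r => simp
  | add p q hp hq => simp only [map_add, hp, hq]
  | mul_X p c hp =>
    simp only [map_mul, hp, aeval_X, eval_X]
    congr 1
    rcases c with c | c <;> simp [embT, evA]

lemma hlp_crit {n d : ℕ} (P : MvPolynomial (XS n) ℂ)
    (hz : ∀ q, d < q → xpart P q = 0) (x : Fin n → ℂ) (s : ℂ) (hc : CritPt P x s) :
    let u : TV n → ℂ := Sum.elim x ![1, s, eval (evA x s) P]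
    eval u (FY d P) = 0 ∧ (∀ i, eval u (pderiv (Sum.inl i) (FY d P)) = 0) ∧
      eval u (pderiv (Sum.inr 0) (FY d P)) = 0 := by
  intro u
  have h0 : eval u (FY d P) = 0 := by
    unfold FY
    simp only [map_sub, map_sum, map_mul, map_pow, eval_X, u, hlp_crit_inl P hz]
    conv_lhs => enter [2]; rw [← hlp_sum P hz]
    simp
  have h1 : ∀ i, eval u (pderiv (Sum.inl i) (FY d P)) = 0 := by
    intro i
    have e : ∀ q, pderiv (Sum.inl i) (aeval embT (xpart P q) : MvPolynomial (TV n) ℂ) =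
        aeval embT (pderiv (Sum.inl i) (xpart P q)) := by
      intro q
      apply hlp_pderiv_aeval
      · simp [embT]
      · rintro (c | c) hne
        · have : c ≠ i := fun h => hne (by rw [h])
          simp [embT, pderiv_X, this]
        · simp [embT, pderiv_X]
    have e2 := hc i
    rw [← hlp_sum P hz] at e2
    unfold FY
    simp only [map_sub, map_sum, Derivation.leibniz, Derivation.leibniz_pow, e, map_add,
      smul_eq_mul, map_mul, map_pow, hlp_crit_inl P hz, u, eval_X] at e2 ⊢
    simpa [pderiv_X] using e2
  refine ⟨h0, h1, ?_⟩
  have hE := congrArg (eval u) (hlp_FY_whom d P).sum_weight_X_mul_pderiv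
  simp only [Fintype.sum_sum_type, Fin.sum_univ_three, hlpWt, map_add, map_sum, map_nsmul,
    map_mul, h1, h0] at hE
  simpa [u] using hE

lemma hlp_pt_scale {n : ℕ} (j : Fin n) (x : Fin n → ℂ) (hx : x j ≠ 0) (s t : ℂ) :
    hlpPt j (chartCo j x) s t =
      fun a => ((x j)⁻¹) ^ (hlpWt n a) * (Sum.elim x ![1, s, t] : TV n → ℂ) a := by
  ext (i | i)
  · by_cases h : i = j
    · subst h; simp [hlpPt, hlpWt, hx]
    · simp [hlpPt, hlpWt, chartCo, h, div_eq_inv_mul]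
  · fin_cases i <;> simp [hlpPt, hlpWt, chartCo]

lemma hlp_crit_chart {n d : ℕ} (hd : 2 < d) (P : MvPolynomial (XS n) ℂ)
    (hz : ∀ q, d < q → xpart P q = 0) (x : Fin n → ℂ) (s : ℂ) (hc : CritPt P x s)
    (j : Fin n) (hx : x j ≠ 0) :
    let u : TV n → ℂ := hlpPt j (chartCo j x) s (eval (evA x s) P)
    eval u (FY d P) = 0 ∧ (∀ i, eval u (pderiv (Sum.inl i) (FY d P)) = 0) ∧
      eval u (pderiv (Sum.inr 0) (FY d P)) = 0 := by
  intro u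
  obtain ⟨h0, h1, h2⟩ := hlp_crit P hz x s hc
  have hF := hlp_FY_whom d P
  simp only [u, hlp_pt_scale j x hx]
  refine ⟨?_, fun i => ?_, ?_⟩
  · rw [hlp_whom_eval hF, h0, mul_zero]
  · rw [hlp_whom_eval (hF.pderiv (n' := d - 1) (i := Sum.inl i) (by simp [hlpWt]; omega)), h1,
      mul_zero]
  · rw [hlp_whom_eval (hF.pderiv (n' := d - 1) (i := Sum.inr 0) (by simp [hlpWt]; omega)), h2,
      mul_zero]

/-- at a point with `x₀ = 0` values, gradients, Hessians of the chart equation do not depend on t -/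
lemma hlp_indep {n d : ℕ} (hd : 2 < d) (P : MvPolynomial (XS n) ℂ) (j : Fin n) (s t t' : ℂ)
    (y : Fin n → ℂ) (hy : y j = 0) :
    eval y (chartEq d P j s t) = eval y (chartEq d P j s t') ∧
    (∀ i, eval y (pderiv i (chartEq d P j s t)) = eval y (pderiv i (chartEq d P j s t'))) ∧
    (∀ i k, eval y (pderiv i (pderiv k (chartEq d P j s t))) =
      eval y (pderiv i (pderiv k (chartEq d P j s t')))) := by
  have h1 : d ≠ 0 := by omega
  have h2 : d - 1 ≠ 0 := by omega
  have h3 : d - 1 - 1 ≠ 0 := by omega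
  rw [hlp_chart_t P j s t, hlp_chart_t P j s t']
  refine ⟨?_, fun i => ?_, fun i k => ?_⟩
  · simp [hy, h1]
  · simp [hy, h2]
  · simp [hy, h2, h3]

lemma hlp_sumV {n : ℕ} (j : Fin n) (f : TV n → ℂ) (hf : f (Sum.inl j) = 0) :
    ∑ i, f (Sum.inl i) + f (Sum.inr 0) = ∑ i, f (hlpV j i) := by
  classical
  rw [← Finset.add_sum_erase _ _ (Finset.mem_univ j),
    ← Finset.add_sum_erase (a := j) _ (fun i => f (hlpV j i)) (Finset.mem_univ j), hf, zero_add,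
    add_comm]
  congr 1
  · simp [hlpV]
  · refine Finset.sum_congr rfl fun i hi => ?_
    simp [hlpV, Finset.ne_of_mem_erase hi]

lemma hlp_pt_tendsto {n : ℕ} (j : Fin n) (y : ℕ → Fin n → ℂ) (s t : ℕ → ℂ) (y0 : Fin n → ℂ)
    (s0 t0 : ℂ) (hy : Tendsto y atTop (nhds y0)) (hs : Tendsto s atTop (nhds s0))
    (ht : Tendsto t atTop (nhds t0)) :
    Tendsto (fun k => hlpPt j (y k) (s k) (t k)) atTop (nhds (hlpPt j y0 s0 t0)) := by
  rw [tendsto_pi_nhds] at hy ⊢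
  rintro (i | i)
  · by_cases h : i = j
    · simp [hlpPt, h]
    · simpa [hlpPt, h] using hy i
  · fin_cases i
    · simpa [hlpPt] using hy j
    · simpa [hlpPt] using hs
    · simpa [hlpPt] using ht

lemma hlp_limit {n : ℕ} (x : ℕ → Fin n → ℂ)
    (hx : Tendsto (fun k => ‖x k‖) atTop atTop) :
    ∃ (p : PrjInf n) (r : ℕ → ℕ), StrictMono r ∧
      (∀ᶠ k in atTop, x (r k) (jp p) ≠ 0) ∧
      Tendsto (fun k => chartCo (jp p) (x (r k))) atTop (nhds (chartPt p)) := by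
  have hcpt := isCompact_closedBall (0 : Fin n → ℂ) 1
  obtain ⟨v, -, r, hr, hv⟩ := hcpt.tendsto_subseq
    (x := fun k => ((‖x k‖ : ℂ)⁻¹) • x k) (by
      intro k
      simp only [Metric.mem_closedBall, dist_zero_right, norm_smul, norm_inv, Complex.norm_real,
        norm_norm]
      exact inv_mul_le_one)
  have hN : Tendsto (fun k => ‖x (r k)‖) atTop atTop := hx.comp hr.tendsto_atTop
  have hpos : ∀ᶠ k in atTop, 0 < ‖x (r k)‖ := hN.eventually_gt_atTop 0
  have hnorm : ‖v‖ = 1 := by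
    refine tendsto_nhds_unique hv.norm ?_
    refine tendsto_const_nhds.congr' ?_
    filter_upwards [hpos] with k hk
    simp [norm_smul, hk.ne']
  have hv0 : v ≠ 0 := by
    rintro rfl
    simp at hnorm
  let p : PrjInf n := Projectivization.mk ℂ v hv0
  obtain ⟨a, ha⟩ := Projectivization.exists_smul_eq_mk_rep ℂ v hv0
  have hrep : ∀ i, p.rep i = (a : ℂ) * v i := fun i => by
    have := congrFun ha i
    simpa [Units.smul_def] using this.symm
  have hj := jp_spec p
  have hvj : v (jp p) ≠ 0 := by
    intro h
    rw [hrep, h, mul_zero] at hj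
    exact hj rfl
  rw [tendsto_pi_nhds] at hv
  have hne : ∀ᶠ k in atTop, x (r k) (jp p) ≠ 0 := by
    filter_upwards [(hv (jp p)).eventually_ne hvj] with k hk h
    simp [h] at hk
  refine ⟨p, r, hr, hne, ?_⟩
  rw [tendsto_pi_nhds]
  intro i
  by_cases h : i = jp p
  · have h1 : Tendsto (fun k => ((‖x (r k)‖ : ℂ)⁻¹)) atTop (nhds 0) := by
      have := (tendsto_inv_atTop_zero.comp hN)
      have h2 := (Complex.continuous_ofReal.tendsto 0).comp this
      simpa [Function.comp_def] using h2
    have h2 := h1.div (hv (jp p)) hvj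
    simp only [chartPt, chartCo, h, if_true]
    rw [zero_div] at h2
    refine h2.congr' ?_
    filter_upwards [hpos, hne] with k hk hk'
    have : (‖x (r k)‖ : ℂ) ≠ 0 := by exact_mod_cast hk.ne'
    simp only [Pi.div_apply, Function.comp, Pi.smul_apply, smul_eq_mul]
    field_simp
  · have h2 := (hv i).div (hv (jp p)) hvj
    simp only [chartPt, chartCo, h, if_false]
    have h3 : p.rep i / p.rep (jp p) = v i / v (jp p) := by
      rw [hrep, hrep, mul_div_mul_left _ _ a.ne_zero]
    rw [h3]
    refine h2.congr' ?_
    filter_upwards [hpos, hne] with k hk hk'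
    have : (‖x (r k)‖ : ℂ) ≠ 0 := by exact_mod_cast hk.ne'
    simp only [Pi.div_apply, Function.comp, Pi.smul_apply, smul_eq_mul]
    field_simp

/-- For a FISI deformation (degree `d > 2`) with nonsingular total
space `Y`, if for some `t` all singularities of `Y_{0,t}` on `H^∞` are of type `A₁`
(vanishing gradient, nondegenerate Hessian of the local chart equation), then
`Γ_{II} = ∅`: no affine critical points of `f_s` can escape to infinity with bounded
critical values as `s → 0`. -/
theorem stmt17 {n d : ℕ} (hn : 2 ≤ n) (hd : 2 < d) (P : MvPolynomial (XS n) ℂ)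
    (hdeg : ∃ ε > (0:ℝ), ∀ s : ℂ, ‖s‖ < ε → DegXAt d P s)
    (hfisi : FISIdef d P)
    (hY : ∃ ε > (0:ℝ), ∀ (u : HV n → ℂ), u ≠ 0 → ∀ s t : ℂ, ‖s‖ < ε →
      ¬ (OnY d P u s t ∧ AllDerivsVanish d P u s t))
    (hA1 : ∃ t : ℂ, ∀ p : PrjInf n,
      (eval (chartPt p) (chartEq d P (jp p) 0 t) = 0 ∧
        ∀ i : Fin n, eval (chartPt p) (pderiv i (chartEq d P (jp p) 0 t)) = 0) →
      (Matrix.of fun i k : Fin n =>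
        eval (chartPt p) (pderiv i (pderiv k (chartEq d P (jp p) 0 t)))).det ≠ 0) :
    ¬ ∃ (x : ℕ → Fin n → ℂ) (s : ℕ → ℂ) (t₀ : ℂ),
        (∀ k, CritPt P (x k) (s k)) ∧
        Tendsto s atTop (nhds 0) ∧
        Tendsto (fun k => ‖x k‖) atTop atTop ∧
        Tendsto (fun k => eval (evA (x k) (s k)) P) atTop (nhds t₀) := by

  rintro ⟨x, s, t₀, hcrit, hs, hx, ht⟩
  obtain ⟨p, r, hr, hne, hy⟩ := hlp_limit x hx
  have hz := hlp_xpart_zero P hdeg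
  set j := jp p with hj
  set y0 := chartPt p with hy0
  have hy0j : y0 j = 0 := by simp [hy0, hj, chartPt]
  set T : ℕ → ℂ := fun k => eval (evA (x (r k)) (s (r k))) P with hT
  have hs' : Tendsto (fun k => s (r k)) atTop (nhds 0) := hs.comp hr.tendsto_atTop
  have ht' : Tendsto T atTop (nhds t₀) := ht.comp hr.tendsto_atTop
  set F := FY d P with hF
  set u0 := hlpPt j y0 0 t₀ with hu0
  have hu := hlp_pt_tendsto j _ _ _ _ _ _ hy hs' ht'
  have hu' := hlp_pt_tendsto j _ _ _ _ _ _ (tendsto_const_nhds (x := y0))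
    (tendsto_const_nhds (x := (0:ℂ))) ht'
  have hsing : ∀ᶠ k in atTop,
      let u : TV n → ℂ := hlpPt j (chartCo j (x (r k))) (s (r k)) (T k)
      eval u F = 0 ∧ (∀ i, eval u (pderiv (Sum.inl i) F) = 0) ∧
        eval u (pderiv (Sum.inr 0) F) = 0 := by
    filter_upwards [hne] with k hk
    exact hlp_crit_chart hd P hz _ _ (hcrit (r k)) j hk
  have hlim : ∀ φ : MvPolynomial (TV n) ℂ, (∀ᶠ k in atTop,
      eval (hlpPt j (chartCo j (x (r k))) (s (r k)) (T k)) φ = 0) → eval u0 φ = 0 := by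
    intro φ hφ
    have h1 := ((MvPolynomial.continuous_eval φ).tendsto _).comp hu
    refine tendsto_nhds_unique h1 (tendsto_const_nhds.congr' ?_)
    filter_upwards [hφ] with k hk
    exact hk.symm
  have g0 : eval u0 F = 0 := hlim F (hsing.mono fun k h => h.1)
  have g1 : ∀ i, eval u0 (pderiv (Sum.inl i) F) = 0 := fun i =>
    hlim _ (hsing.mono fun k h => h.2.1 i)
  have g2 : eval u0 (pderiv (Sum.inr 0) F) = 0 := hlim _ (hsing.mono fun k h => h.2.2)
  have gV : ∀ i, eval u0 (pderiv (hlpV j i) F) = 0 := by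
    intro i
    unfold hlpV
    split_ifs
    exacts [g2, g1 i]
  have g3 : eval u0 (pderiv (Sum.inr 2) F) = 0 := by
    have h1 : ∀ q, pderiv (Sum.inr 2) (aeval embT (xpart P q) : MvPolynomial (TV n) ℂ) = 0 := by
      intro q
      induction xpart P q using MvPolynomial.induction_on with
      | C r => simp
      | add p q hp hq => simp only [map_add, hp, hq, add_zero]
      | mul_X p c hp =>
        simp only [map_mul, Derivation.leibniz, hp, aeval_X]
        rcases c with c | c <;> simp [embT, pderiv_X]
    have h2 : d ≠ 0 := by omega
    simp only [hF, FY, map_sub, map_sum, Derivation.leibniz, Derivation.leibniz_pow, h1]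
    simp [pderiv_X, hu0, hlpPt, hy0j, h2]
  have gs : eval u0 (pderiv (Sum.inr 1) F) ≠ 0 := by
    intro h
    obtain ⟨ε, hε, hYε⟩ := hY
    let U : HV n → ℂ := Sum.elim (fun i => if i = j then 1 else y0 i) (fun _ => y0 j)
    have hU : evT U 0 t₀ = u0 := by
      ext (i | i)
      · rfl
      · fin_cases i <;> rfl
    refine hYε U ?_ 0 t₀ (by simpa using hε) ⟨?_, ?_⟩
    · intro h0
      have := congrFun h0 (Sum.inl j)
      simp [U] at this
    · unfold OnY; rw [hU]; exact g0
    · intro v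
      rw [hU]
      rcases v with i | i
      · exact g1 i
      · fin_cases i
        exacts [g2, h, g3]
  -- values at other `t`
  have eVal : ∀ t, eval (hlpPt j y0 0 t) F = 0 := by
    intro t
    rw [← hlp_chart_eval]
    rw [← hlp_chart_eval] at g0
    exact ((hlp_indep hd P j 0 t t₀ y0 hy0j).1).trans g0
  have eDer : ∀ t i, eval (hlpPt j y0 0 t) (pderiv (hlpV j i) F) = 0 := by
    intro t i
    have := gV i
    rw [← hlp_chart_eval, ← hlp_chart_pderiv] at this ⊢
    exact ((hlp_indep hd P j 0 t t₀ y0 hy0j).2.1 i).trans this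
  obtain ⟨t₁, hA⟩ := hA1
  have hdet := hA p ⟨by
      have := eVal t₁
      rwa [← hlp_chart_eval] at this, fun i => by
      have := eDer t₁ i
      rwa [← hlp_chart_eval, ← hlp_chart_pderiv] at this⟩
  have hH : ∀ i k, eval (chartPt p) (pderiv i (pderiv k (chartEq d P (jp p) 0 t₁))) =
      eval u0 (pderiv (hlpV j i) (pderiv (hlpV j k) F)) := by
    intro i k
    rw [hu0, ← hlp_chart_eval, ← hlp_chart_pderiv, ← hlp_chart_pderiv]
    exact (hlp_indep hd P j 0 t₁ t₀ y0 hy0j).2.2 i k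
  -- the local injectivity argument
  let R : TV n → MvPolynomial (TV n) ℂ :=
    Sum.elim (fun i => if i = j then X (Sum.inl j) else pderiv (Sum.inl i) F)
      ![pderiv (Sum.inr 0) F, F, X (Sum.inr 2)]
  have hRV : ∀ i, R (hlpV j i) = pderiv (hlpV j i) F := by
    intro i
    by_cases h : i = j <;> simp [hlpV, R, h]
  obtain ⟨Ψ, hΨ⟩ := hlp_inj R u0 (by
    intro w hw
    have w1 : w (Sum.inl j) = 0 := by
      have := hw (Sum.inl j)
      simpa [R, pderiv_X, Pi.single_apply] using this
    have w2 : w (Sum.inr 2) = 0 := by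
      have := hw (Sum.inr 2)
      simpa [R, pderiv_X, Pi.single_apply] using this
    have w3 : w (Sum.inr 1) = 0 := by
      have := hw (Sum.inr 1)
      have hR1 : R (Sum.inr 1) = F := rfl
      simp only [hR1, Fintype.sum_sum_type, Fin.sum_univ_three, g1, g2, g3, zero_mul,
        Finset.sum_const_zero, zero_add, add_zero, mul_eq_zero] at this
      exact this.resolve_left gs
    have w4 : (fun i => w (hlpV j i)) = 0 := by
      refine Matrix.eq_zero_of_vecMul_eq_zero hdet ?_
      ext i
      have := hw (hlpV j i)
      simp only [Fintype.sum_sum_type, Fin.sum_univ_three, w3, w2, mul_zero, add_zero, hRV] at this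
      have h5 := hlp_sumV j (fun b => eval u0 (pderiv b (pderiv (hlpV j i) F)) * w b)
        (by simp [w1])
      rw [h5] at this
      simp only [Matrix.vecMul, dotProduct, Matrix.of_apply, hH, Pi.zero_apply]
      rw [← this]
      exact Finset.sum_congr rfl fun k _ => mul_comm _ _
    ext (i | i)
    · by_cases h : i = j
      · rw [h]; exact w1
      · have := congrFun w4 i
        simpa [hlpV, h] using this
    · fin_cases i
      · have := congrFun w4 j
        simpa [hlpV] using this
      · exact w3
      · exact w2)
  have hfin := (hu.eventually hΨ).and ((hu'.eventually hΨ).and (hsing.and hne))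
  obtain ⟨k, e1, e2, ⟨c0, c1, c2⟩, hk⟩ := hfin.exists
  have hEq : (fun a => eval (hlpPt j (chartCo j (x (r k))) (s (r k)) (T k)) (R a)) =
      fun a => eval (hlpPt j y0 0 (T k)) (R a) := by
    ext (i | i)
    · by_cases h : i = j
      · simp [R, h, hlpPt]
      · have := eDer (T k) i
        simp only [hlpV, h, if_false] at this
        simp only [R, Sum.elim_inl, h, if_false, c1 i, this]
    · fin_cases i
      · have := eDer (T k) j
        simp only [hlpV, if_true] at this
        exact c2.trans this.symm
      · exact c0.trans (eVal (T k)).symm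
      · simp [R, hlpPt]
  rw [hEq] at e1
  have h6 := congrFun (e1.symm.trans e2) (Sum.inr 0)
  simp [hlpPt, chartCo, hy0j] at h6
  exact hk h6
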